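/- Let F ∈ ℂ[x₀,x₁,x₂,y₀,y₁,y₂] be a nonzero bihomogeneous polynomial, let H = {F = 0} ⊆ ℙ² × ℙ², and let X be a nonempty Zariski-open subset of ℙ². If H ∩ (X × ℙ²) is (2,2)-grid-free, then there exists a bihomogeneous polynomial F' ∈ ℂ[x₀,x₁,x₂,y₀,y₁,y₂] whose degree in the y-variables is at most 2 such that H ∩ (X × ℙ²) = {F' = 0} ∩ (X × ℙ²). -/

import Mathlib

open MvPolynomial

noncomputable section

/-- Points of `ℙⁿ⁻¹` over `ℂ`: nonzero vectors of `ℂⁿ` up to scalar. -/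
abbrev Pt (n : ℕ) := Projectivization ℂ (Fin n → ℂ)

/-- Weight function selecting the `x`-variables. -/
def wx (n : ℕ) : Fin n ⊕ Fin n → ℕ := Sum.elim (fun _ => 1) (fun _ => 0)

/-- Weight function selecting the `y`-variables. -/
def wy (n : ℕ) : Fin n ⊕ Fin n → ℕ := Sum.elim (fun _ => 0) (fun _ => 1)

/-- A polynomial in the variables `x₀,…,x_{n-1},y₀,…,y_{n-1}` is bihomogeneous if it is
homogeneous in the `x`-variables and homogeneous in the `y`-variables. -/
def Bihom {n : ℕ} (F : MvPolynomial (Fin n ⊕ Fin n) ℂ) : Prop :=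
  ∃ a b, F.IsWeightedHomogeneous (wx n) a ∧ F.IsWeightedHomogeneous (wy n) b

/-- The degree of `F` in the `x`-variables. -/
def xdeg {n : ℕ} (F : MvPolynomial (Fin n ⊕ Fin n) ℂ) : ℕ :=
  MvPolynomial.weightedTotalDegree (wx n) F

/-- The degree of `F` in the `y`-variables. -/
def ydeg {n : ℕ} (F : MvPolynomial (Fin n ⊕ Fin n) ℂ) : ℕ :=
  MvPolynomial.weightedTotalDegree (wy n) F

/-- The zero set in `ℙⁿ⁻¹ × ℙⁿ⁻¹` of a bihomogeneous polynomial. -/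
def zeroSet {n : ℕ} (F : MvPolynomial (Fin n ⊕ Fin n) ℂ) : Set (Pt n × Pt n) :=
  {p | eval (Sum.elim p.1.rep p.2.rep) F = 0}

/-- A Zariski-open subset of `ℙⁿ⁻¹`: the complement of the common zero set of a finite
family of homogeneous polynomials. -/
def ZarOpen {n : ℕ} (X : Set (Pt n)) : Prop :=
  ∃ S : Finset (MvPolynomial (Fin n) ℂ),
    (∀ g ∈ S, ∃ d, g.IsHomogeneous d) ∧
    X = {p : Pt n | ¬ ∀ g ∈ S, eval p.rep g = 0}

/-- `V ⊆ P₁ × P₂` is `(s,t)`-grid-free if there are no `S ⊆ P₁`, `T ⊆ P₂` with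
`|S| = s`, `|T| = t` and `S × T ⊆ V`. -/
def GridFree {α β : Type*} (s t : ℕ) (V : Set (α × β)) : Prop :=
  ¬ ∃ (S : Finset α) (T : Finset β), S.card = s ∧ T.card = t ∧
      ∀ a ∈ S, ∀ b ∈ T, (a, b) ∈ V

/-- The ring homomorphism `p ↦ ∑ₖ pₖ Tᵏ`, where `pₖ` is the weighted homogeneous component of
weight `k` of `p`. -/
def gradedHom {σ : Type*} (w : σ → ℕ) :
    MvPolynomial σ ℂ →ₐ[ℂ] Polynomial (MvPolynomial σ ℂ) :=
  aeval fun i => Polynomial.C (X i) * Polynomial.X ^ w i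

lemma gradedHom_monomial {σ : Type*} (w : σ → ℕ) (d : σ →₀ ℕ) (c : ℂ) :
    gradedHom w (monomial d c) =
      Polynomial.C (monomial d c) * Polynomial.X ^ Finsupp.weight w d := by
  rw [gradedHom, aeval_monomial, monomial_eq, Finsupp.weight_apply, map_mul]
  simp only [mul_pow, Finsupp.prod, Finsupp.sum, Finset.prod_mul_distrib, map_prod, map_pow,
    Finset.prod_pow_eq_pow_sum, smul_eq_mul, ← pow_mul, mul_comm (w _), mul_assoc]
  rfl

lemma coeff_gradedHom {σ : Type*} (w : σ → ℕ) (p : MvPolynomial σ ℂ) (k : ℕ) (d : σ →₀ ℕ) :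
    coeff d ((gradedHom w p).coeff k) = if Finsupp.weight w d = k then coeff d p else 0 := by
  classical
  induction p using MvPolynomial.induction_on' with
  | monomial u a =>
    rw [gradedHom_monomial, Polynomial.coeff_C_mul_X_pow]
    by_cases h : u = d
    · subst h
      split_ifs <;> simp_all
    · split_ifs <;> simp_all [coeff_monomial]
  | add p q hp hq =>
    rw [map_add, Polynomial.coeff_add, coeff_add, hp, hq, coeff_add]
    split_ifs <;> simp

lemma gradedHom_injective {σ : Type*} (w : σ → ℕ) : Function.Injective (gradedHom w) := by
  intro p q h
  ext d
  simpa [coeff_gradedHom] using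
    congrArg (fun r => coeff d (r.coeff (Finsupp.weight w d))) h

lemma isWeightedHomogeneous_iff_gradedHom {σ : Type*} {w : σ → ℕ} {p : MvPolynomial σ ℂ} {m : ℕ} :
    p.IsWeightedHomogeneous w m ↔ ∀ k, k ≠ m → (gradedHom w p).coeff k = 0 := by
  constructor
  · intro h k hk
    ext d
    rw [coeff_gradedHom, coeff_zero]
    split_ifs with hd
    · by_contra hc
      exact hk (hd.symm.trans (h hc))
    · rfl
  · intro h d hd
    by_contra hne
    apply hd
    have := congrArg (coeff d) (h _ hne)
    simpa [coeff_gradedHom] using this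

/-- A factor of a nonzero weighted homogeneous polynomial is weighted homogeneous. -/
lemma exists_isWeightedHomogeneous_left_of_mul {σ : Type*} {w : σ → ℕ} {p q : MvPolynomial σ ℂ}
    {n : ℕ} (h : (p * q).IsWeightedHomogeneous w n) (hpq : p * q ≠ 0) :
    ∃ m, p.IsWeightedHomogeneous w m := by
  have hp0 : gradedHom w p ≠ 0 := fun e => left_ne_zero_of_mul hpq
    (gradedHom_injective w (e.trans (map_zero _).symm))
  have hq0 : gradedHom w q ≠ 0 := fun e => right_ne_zero_of_mul hpq
    (gradedHom_injective w (e.trans (map_zero _).symm))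
  have hpq0 : gradedHom w (p * q) ≠ 0 := by rw [map_mul]; exact mul_ne_zero hp0 hq0
  rw [isWeightedHomogeneous_iff_gradedHom] at h
  have h1 : (gradedHom w (p * q)).natDegree = n := by
    by_contra hne
    exact hpq0 (Polynomial.leadingCoeff_eq_zero.1 (h _ hne))
  have h2 : (gradedHom w (p * q)).natTrailingDegree = n := by
    by_contra hne
    exact hpq0 (Polynomial.trailingCoeff_eq_zero.1 (h _ hne))
  rw [map_mul, Polynomial.natDegree_mul hp0 hq0] at h1
  rw [map_mul, Polynomial.natTrailingDegree_mul hp0 hq0] at h2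
  have h3 := Polynomial.natTrailingDegree_le_natDegree (gradedHom w p)
  have h4 := Polynomial.natTrailingDegree_le_natDegree (gradedHom w q)
  refine ⟨(gradedHom w p).natDegree, isWeightedHomogeneous_iff_gradedHom.2 fun k hk => ?_⟩
  rcases lt_or_gt_of_ne hk with hlt | hgt
  · exact Polynomial.coeff_eq_zero_of_lt_natTrailingDegree (by omega)
  · exact Polynomial.coeff_eq_zero_of_natDegree_lt hgt

lemma IsWeightedHomogeneous.eval_pow_mul {σ : Type*} {w : σ → ℕ} {p : MvPolynomial σ ℂ} {m : ℕ}
    (h : p.IsWeightedHomogeneous w m) (t : ℂ) (z : σ → ℂ) :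
    eval (fun i => t ^ w i * z i) p = t ^ m * eval z p := by
  rw [eval_eq, eval_eq, Finset.mul_sum]
  refine Finset.sum_congr rfl fun d hd => ?_
  rw [← h (mem_support_iff.1 hd), Finsupp.weight_apply]
  simp only [mul_pow, Finset.prod_mul_distrib, Finsupp.sum, smul_eq_mul, ← pow_mul,
    Finset.prod_pow_eq_pow_sum, mul_comm (w _)]
  ring

lemma pderiv_eq_zero_of_dvd {σ : Type*} {w : σ → ℕ} {p : MvPolynomial σ ℂ} {m : ℕ} {i : σ}
    (h : p.IsWeightedHomogeneous w m) (hm : m ≠ 0) (hi : w i = 1) (hd : p ∣ pderiv i p) :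
    pderiv i p = 0 := by
  by_contra hne
  obtain ⟨q, hq⟩ := hd
  have h1 : (pderiv i p).IsWeightedHomogeneous w (m - 1) := h.pderiv (by omega)
  obtain ⟨k, hk⟩ := exists_isWeightedHomogeneous_left_of_mul (p := q) (q := p)
    (by rwa [mul_comm, ← hq]) (by rwa [mul_comm, ← hq])
  have h2 := h1.inj_right hne (hq ▸ h.mul hk)
  omega

lemma exists_pderiv_ne_zero {σ : Type*} [Fintype σ] {w : σ → ℕ} {p : MvPolynomial σ ℂ} {m : ℕ}
    (h : p.IsWeightedHomogeneous w m) (hm : m ≠ 0) (hp : p ≠ 0) :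
    ∃ i, w i ≠ 0 ∧ pderiv i p ≠ 0 := by
  by_contra! hc
  have h1 := h.sum_weight_X_mul_pderiv
  rw [Finset.sum_eq_zero] at h1
  · exact (smul_ne_zero hm hp) h1.symm
  · intro i _
    by_cases hi : w i = 0
    · simp [hi]
    · simp [hc i hi]

lemma not_dvd_pderiv_mul {σ : Type*} {p q : MvPolynomial σ ℂ} {i : σ} (hp : Prime p)
    (hq : ¬ p ∣ q) (hi : ¬ p ∣ pderiv i p) : ¬ p ∣ pderiv i (p * q) := by
  rw [Derivation.leibniz, smul_eq_mul, smul_eq_mul]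
  intro h
  rcases hp.dvd_or_dvd ((dvd_add_right (dvd_mul_right p _)).1 h) with h | h
  exacts [hq h, hi h]

/-- Nullstellensatz for an irreducible hypersurface. -/
lemma exists_eval_eq_zero_of_not_dvd {σ : Type*} [Finite σ] {p q : MvPolynomial σ ℂ}
    (hp : Prime p) (hq : ¬ p ∣ q) : ∃ z : σ → ℂ, eval z p = 0 ∧ eval z q ≠ 0 := by
  by_contra! hc
  apply hq
  have : (Ideal.span {p}).IsPrime := (Ideal.span_singleton_prime hp.ne_zero).2 hp
  rw [← Ideal.mem_span_singleton, ← IsPrime.vanishingIdeal_zeroLocus (K := ℂ) (Ideal.span {p})]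
  intro z hz
  have := hc z (by simpa using hz p (Ideal.mem_span_singleton_self p))
  simpa using this

lemma algHom_aeval_eq_eval {σ B : Type*} [CommRing B] [Algebra ℂ B] (ψ : B →ₐ[ℂ] ℂ)
    (z : σ → B) (p : MvPolynomial σ ℂ) : ψ (aeval z p) = eval (fun i => ψ (z i)) p := by
  rw [comp_aeval_apply, aeval_eq_eval]

/-- A complex polynomial in two variables has no isolated zeros. -/
lemma exists_ne_zero_eval_eq_zero (r : MvPolynomial (Fin 2) ℂ) (h0 : eval 0 r = 0) :
    ∃ c : Fin 2 → ℂ, c ≠ 0 ∧ eval c r = 0 := by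
  by_contra! hc
  have h1 : ∀ a ≠ 0, ∀ b, eval ![a, b] r = eval ![a, 0] r := by
    intro a ha
    let ρ : Polynomial ℂ := aeval ![Polynomial.C a, Polynomial.X] r
    have hρ : ∀ b, ρ.eval b = eval ![a, b] r := by
      intro b
      rw [← Polynomial.coe_aeval_eq_eval, algHom_aeval_eq_eval]
      congr 2
      ext i
      fin_cases i <;> simp
    have hdeg : ρ.degree = 0 := by
      by_contra hd
      obtain ⟨b, hb⟩ := IsAlgClosed.exists_root ρ hd
      refine hc ![a, b] (fun h => ha (by simpa using congrFun h 0)) ?_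
      rw [← hρ, hb]
    intro b
    rw [← hρ, ← hρ, Polynomial.eq_C_of_degree_eq_zero hdeg]
    simp
  have h2 : (fun a : ℂ => eval ![a, 1] r) = fun a => eval ![a, 0] r := by
    refine Continuous.ext_on (dense_compl_singleton (0 : ℂ)) ?_ ?_ fun a ha => h1 a ha 1
    · exact (continuous_eval r).comp (by fun_prop)
    · exact (continuous_eval r).comp (by fun_prop)
  have h3 := congrFun h2 0
  have h4 : (![0, 0] : Fin 2 → ℂ) = 0 := by ext i; fin_cases i <;> rfl
  simp only [h4, h0] at h3
  exact hc ![0, 1] (by intro h; simpa using congrFun h 1) h3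

lemma exists_eval_add_smul_eq_zero {σ : Type*} (p : MvPolynomial σ ℂ) (c u v : σ → ℂ)
    (h0 : eval c p = 0) : ∃ a b : ℂ, (a ≠ 0 ∨ b ≠ 0) ∧ eval (c + (a • u + b • v)) p = 0 := by
  let r : MvPolynomial (Fin 2) ℂ := aeval (fun i => C (c i) + (X 0 * C (u i) + X 1 * C (v i))) p
  have hr : ∀ z : Fin 2 → ℂ, eval z r = eval (c + (z 0 • u + z 1 • v)) p := by
    intro z
    rw [← aeval_eq_eval, algHom_aeval_eq_eval]
    congr 2
    ext i
    simp
  obtain ⟨z, hz, hz0⟩ := exists_ne_zero_eval_eq_zero r (by rw [hr]; simpa using h0)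
  refine ⟨z 0, z 1, ?_, by rw [← hr, hz0]⟩
  by_contra! h
  exact hz (by ext i; fin_cases i <;> simp [h])

section Bezout

open Polynomial in
lemma exists_common_root_of_resultant_eq_zero {k l : Polynomial ℂ} {m : ℕ}
    (hk : k.natDegree ≤ m) (hl : l.natDegree ≤ m) (h : resultant k l m m = 0) :
    (k.coeff m = 0 ∧ l.coeff m = 0) ∨ ∃ t, k.eval t = 0 ∧ l.eval t = 0 := by
  wlog hkm : k.coeff m ≠ 0 generalizing k l
  · by_cases hlm : l.coeff m = 0
    · exact Or.inl ⟨not_not.1 hkm, hlm⟩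
    · rcases this hl hk (by rw [resultant_comm, h, mul_zero]) hlm with h' | ⟨t, h1, h2⟩
      exacts [Or.inl h'.symm, Or.inr ⟨t, h2, h1⟩]
  right
  have hkd : k.natDegree = m := le_antisymm hk (le_natDegree_of_ne_zero hkm)
  obtain ⟨j, hj⟩ := Nat.exists_eq_add_of_le hl
  have h1 : resultant k l m (l.natDegree + j) = 0 := hj ▸ h
  rw [resultant_add_right_deg _ _ _ _ _ le_rfl, mul_eq_zero,
    or_iff_right (pow_ne_zero _ hkm), ← hkd, resultant_eq_zero_iff,
    isCoprime_iff_aeval_ne_zero_of_isAlgClosed ℂ ℂ] at h1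
  simpa using h1.2

/-- The restriction of `p` to the line through `u` with direction `v`. -/
def lineRestrict {σ A : Type*} [CommRing A] [Algebra ℂ A] (p : MvPolynomial σ ℂ) (u v : σ → A) :
    Polynomial A :=
  aeval (fun i => Polynomial.C (u i) + Polynomial.X * Polynomial.C (v i)) p

lemma eval_lineRestrict {σ : Type*} (p : MvPolynomial σ ℂ) (u v : σ → ℂ) (t : ℂ) :
    (lineRestrict p u v).eval t = eval (u + t • v) p := by
  rw [← Polynomial.coe_aeval_eq_eval, lineRestrict, algHom_aeval_eq_eval]
  congr 2
  ext i
  simp only [map_add, map_mul, Polynomial.aeval_C, Polynomial.aeval_X, Algebra.algebraMap_self,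
    RingHom.id_apply, Pi.add_apply, Pi.smul_apply, smul_eq_mul]

lemma map_lineRestrict {σ A B : Type*} [CommRing A] [Algebra ℂ A] [CommRing B] [Algebra ℂ B]
    (p : MvPolynomial σ ℂ) (u v : σ → A) (ψ : A →ₐ[ℂ] B) :
    (lineRestrict p u v).map (ψ : A →+* B) =
      lineRestrict p (fun i => ψ (u i)) (fun i => ψ (v i)) := by
  have := comp_aeval_apply (R := ℂ)
    (fun i => Polynomial.C (u i) + Polynomial.X * Polynomial.C (v i)) (Polynomial.mapAlgHom ψ) p
  simpa [lineRestrict] using this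

lemma lineRestrict_monomial {σ : Type*} (d : σ →₀ ℕ) (c : ℂ) (u v : σ → ℂ) :
    lineRestrict (monomial d c) u v = Polynomial.C c *
      ∏ i ∈ d.support, (Polynomial.C (u i) + Polynomial.X * Polynomial.C (v i)) ^ d i := by
  rw [lineRestrict, aeval_monomial]
  rfl

lemma coeff_prod_of_natDegree_le_sum {ι : Type*} (s : Finset ι) (f : ι → Polynomial ℂ) (n : ι → ℕ)
    (h : ∀ i ∈ s, (f i).natDegree ≤ n i) :
    (∏ i ∈ s, f i).coeff (∑ i ∈ s, n i) = ∏ i ∈ s, (f i).coeff (n i) := by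
  classical
  induction s using Finset.induction_on with
  | empty => simp
  | insert a s ha ih =>
    have hs : ∀ i ∈ s, (f i).natDegree ≤ n i := fun i hi => h i (Finset.mem_insert_of_mem hi)
    rw [Finset.prod_insert ha, Finset.sum_insert ha, Finset.prod_insert ha, ← ih hs]
    exact Polynomial.coeff_mul_add_eq_of_natDegree_le (h a (Finset.mem_insert_self a s))
      ((Polynomial.natDegree_prod_le _ _).trans (Finset.sum_le_sum hs))

lemma natDegree_lineRestrict_le {σ : Type*} {p : MvPolynomial σ ℂ} {d : ℕ}
    (hp : p.IsHomogeneous d) (u v : σ → ℂ) :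
    (lineRestrict p u v).natDegree ≤ d ∧ (lineRestrict p u v).coeff d = eval v p := by
  have hlin : ∀ i, (Polynomial.C (u i) + Polynomial.X * Polynomial.C (v i)).natDegree ≤ 1 :=
    fun i => by compute_degree
  have hmon : ∀ m ∈ p.support, (lineRestrict (monomial m (coeff m p)) u v).natDegree ≤ d ∧
      (lineRestrict (monomial m (coeff m p)) u v).coeff d = eval v (monomial m (coeff m p)) := by
    intro m hm
    have hd : ∑ i ∈ m.support, m i = d := by
      have := hp (mem_support_iff.1 hm)
      simpa [Finsupp.weight_apply, Finsupp.sum] using this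
    have hpow : ∀ i ∈ m.support,
        ((Polynomial.C (u i) + Polynomial.X * Polynomial.C (v i)) ^ m i).natDegree ≤ m i :=
      fun i _ => (Polynomial.natDegree_pow_le_of_le _ (hlin i)).trans (by omega)
    rw [lineRestrict_monomial]
    constructor
    · refine (Polynomial.natDegree_C_mul_le _ _).trans ?_
      refine (Polynomial.natDegree_prod_le _ _).trans ?_
      exact (Finset.sum_le_sum hpow).trans hd.le
    · rw [Polynomial.coeff_C_mul, eval_monomial, Finsupp.prod]
      congr 1
      rw [← hd, coeff_prod_of_natDegree_le_sum _ _ _ hpow]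
      refine Finset.prod_congr rfl fun i _ => ?_
      have := Polynomial.coeff_pow_of_natDegree_le (hlin i) (m := m i)
      simpa using this
  have hsum : lineRestrict p u v = ∑ m ∈ p.support, lineRestrict (monomial m (coeff m p)) u v := by
    conv_lhs => rw [p.as_sum]
    simp only [lineRestrict, map_sum]
  rw [hsum]
  constructor
  · exact Polynomial.natDegree_sum_le_of_forall_le _ _ fun m hm => (hmon m hm).1
  · rw [Polynomial.finsetSum_coeff]
    conv_rhs => rw [p.as_sum, map_sum]
    exact Finset.sum_congr rfl fun m hm => (hmon m hm).2

/-- Two plane curves of the same degree `d ≥ 2` that meet transversally at a point `p` meet in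
another point. -/
lemma exists_second_common_zero {σ : Type*} {f g : MvPolynomial σ ℂ} {d : ℕ} (hd : 2 ≤ d)
    (hf : f.IsHomogeneous d) (hg : g.IsHomogeneous d) {p u v : σ → ℂ}
    (hli : ∀ c a b : ℂ, c • p + (a • u + b • v) = 0 → c = 0 ∧ a = 0 ∧ b = 0)
    (hfp : eval p f = 0) (hgp : eval p g = 0)
    (htrans : ∀ a b : ℂ, deriv (fun t : ℂ => eval (p + t • (a • u + b • v)) f) 0 = 0 →
      deriv (fun t : ℂ => eval (p + t • (a • u + b • v)) g) 0 = 0 → a = 0 ∧ b = 0) :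
    ∃ q : σ → ℂ, LinearIndependent ℂ ![p, q] ∧ eval q f = 0 ∧ eval q g = 0 := by
  let w : σ → MvPolynomial (Fin 2) ℂ := fun i => X 0 * C (u i) + X 1 * C (v i)
  let q : (Fin 2 → ℂ) → σ → ℂ := fun z => z 0 • u + z 1 • v
  let K : MvPolynomial σ ℂ → Polynomial (MvPolynomial (Fin 2) ℂ) := fun h =>
    (lineRestrict h (fun i => C (p i)) w).divX
  let k : MvPolynomial σ ℂ → (Fin 2 → ℂ) → Polynomial ℂ := fun h z =>
    (lineRestrict h p (q z)).divX
  have hK : ∀ h z, (K h).map (eval z) = k h z := by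
    intro h z
    have h1 := map_lineRestrict h (fun i => C (p i)) w (aeval z : MvPolynomial (Fin 2) ℂ →ₐ[ℂ] ℂ)
    have h2 : (fun i => aeval z (C (p i) : MvPolynomial (Fin 2) ℂ)) = p := by ext i; simp
    have h3 : (fun i => aeval z (w i)) = q z := by ext i; simp [w, q]
    rw [h2, h3] at h1
    ext n
    simp only [K, k, Polynomial.coeff_map, Polynomial.coeff_divX, ← h1]
    simp
  have hk0 : ∀ h, eval p h = 0 → k h 0 = 0 := by
    intro h hh
    have : lineRestrict h p (q 0) = Polynomial.C (eval p h) := by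
      refine Polynomial.funext fun t => ?_
      simp [eval_lineRestrict, q]
    simp only [k, this, Polynomial.divX_C]
  have hkdeg : ∀ h, h.IsHomogeneous d → ∀ z,
      (k h z).natDegree ≤ d - 1 ∧ (k h z).coeff (d - 1) = eval (q z) h := by
    intro h hh z
    obtain ⟨h1, h2⟩ := natDegree_lineRestrict_le hh p (q z)
    simp only [k, Polynomial.natDegree_divX_eq_natDegree_tsub_one, Polynomial.coeff_divX]
    exact ⟨by omega, by rw [← h2]; congr 1; omega⟩
  have hkeval : ∀ h, eval p h = 0 → ∀ z t, eval (p + t • q z) h = t * (k h z).eval t := by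
    intro h hh z t
    have h1 := Polynomial.divX_mul_X_add (lineRestrict h p (q z))
    have h2 : (lineRestrict h p (q z)).coeff 0 = 0 := by
      rw [Polynomial.coeff_zero_eq_eval_zero, eval_lineRestrict]
      simpa using hh
    rw [← eval_lineRestrict, ← h1, h2]
    simp [k, mul_comm]
  have hkderiv : ∀ h, eval p h = 0 → ∀ z, (k h z).eval 0 = 0 →
      deriv (fun t : ℂ => eval (p + t • q z) h) 0 = 0 := by
    intro h hh z hz
    have h1 : (fun t : ℂ => eval (p + t • q z) h) = fun t => t * (k h z).eval t := by
      ext t; exact hkeval h hh z t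
    have h2 : HasDerivAt (fun t : ℂ => t * (k h z).eval t) _ 0 :=
      (hasDerivAt_id' (0 : ℂ)).mul ((k h z).hasDerivAt 0)
    rw [h1, h2.deriv]
    simp [hz]
  obtain ⟨z, hz, hres⟩ := exists_ne_zero_eval_eq_zero
    (Polynomial.resultant (K f) (K g) (d - 1) (d - 1)) (by
      rw [← Polynomial.resultant_map_map, hK, hK, hk0 f hfp, hk0 g hgp,
        Polynomial.resultant_zero_zero]
      exact zero_pow (by omega))
  rw [← Polynomial.resultant_map_map, hK, hK] at hres
  have hz' : ¬ (z 0 = 0 ∧ z 1 = 0) := fun h => hz (by ext i; fin_cases i <;> simp [h])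
  have hq : ∀ c t : ℂ, c • p + t • q z = 0 → c = 0 ∧ t = 0 := by
    intro c t h
    obtain ⟨h1, h2, h3⟩ := hli c (t * z 0) (t * z 1) (by rw [← h]; simp [q, mul_smul])
    refine ⟨h1, by_contra fun ht => hz' ⟨?_, ?_⟩⟩
    exacts [(mul_eq_zero.1 h2).resolve_left ht, (mul_eq_zero.1 h3).resolve_left ht]
  rcases exists_common_root_of_resultant_eq_zero (hkdeg f hf z).1 (hkdeg g hg z).1 hres with
    ⟨h1, h2⟩ | ⟨t, h1, h2⟩
  · refine ⟨q z, LinearIndependent.pair_iff.2 hq, ?_, ?_⟩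
    · rw [← (hkdeg f hf z).2, h1]
    · rw [← (hkdeg g hg z).2, h2]
  · have ht : t ≠ 0 := by
      rintro rfl
      exact hz' (htrans _ _ (hkderiv f hfp z h1) (hkderiv g hgp z h2))
    refine ⟨p + t • q z, LinearIndependent.pair_iff.2 fun a b hab => ?_, ?_, ?_⟩
    · obtain ⟨h3, h4⟩ := hq (a + b) (b * t) (by rw [← hab]; module)
      have hb : b = 0 := (mul_eq_zero.1 h4).resolve_right ht
      exact ⟨by simpa [hb] using h3, hb⟩
    · rw [hkeval f hfp, h1, mul_zero]
    · rw [hkeval g hgp, h2, mul_zero]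

end Bezout

section Calculus

open Topology

lemma hasDerivAt_eval {σ : Type*} [Fintype σ] (p : MvPolynomial σ ℂ) {c : ℂ → σ → ℂ} {c' : σ → ℂ}
    {t : ℂ} (hc : ∀ i, HasDerivAt (fun s => c s i) (c' i) t) :
    HasDerivAt (fun s => eval (c s) p) (∑ i, eval (c t) (pderiv i p) * c' i) t := by
  classical
  induction p using MvPolynomial.induction_on with
  | C a => simpa using hasDerivAt_const t a
  | add p q hp hq =>
    have h1 : (fun s => eval (c s) (p + q)) = (fun s => eval (c s) p) + fun s => eval (c s) q := by
      ext s; simp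
    rw [h1]
    exact (hp.add hq).congr_deriv (by simp [add_mul, Finset.sum_add_distrib])
  | mul_X p i hp =>
    have h := hp.mul (hc i)
    have h1 : (fun s => eval (c s) (p * X i)) = (fun s => eval (c s) p) * fun s => c s i := by
      ext s; simp
    rw [h1]
    refine h.congr_deriv (Eq.symm ?_)
    simp only [Derivation.leibniz, pderiv_X, smul_eq_mul, map_add, map_mul, eval_X, add_mul,
      Finset.sum_add_distrib, Finset.sum_mul]
    rw [add_comm]
    congr 1
    · exact Finset.sum_congr rfl fun j _ => by ring
    · rw [Finset.sum_eq_single i]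
      · simp
      · intro j _ hj
        simp [Pi.single_eq_of_ne hj.symm]
      · simp

lemma contDiffAt_eval {σ E : Type*} [Fintype σ] [NormedAddCommGroup E] [NormedSpace ℂ E]
    (p : MvPolynomial σ ℂ) {c : E → σ → ℂ} {e : E} (hc : ∀ i, ContDiffAt ℂ 1 (fun z => c z i) e) :
    ContDiffAt ℂ 1 (fun z => eval (c z) p) e := by
  have h1 : ContDiffAt ℂ 1 (fun z : σ → ℂ => eval z p) (c e) :=
    (AnalyticOnNhd.eval_mvPolynomial p (c e) (Set.mem_univ _)).contDiffAt
  exact h1.comp e (contDiffAt_pi.2 hc)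

lemma exists_implicit {E : Type*} [NormedAddCommGroup E] [NormedSpace ℂ E] [CompleteSpace E]
    {φ : E × ℂ → ℂ} {D : ℂ} (hφ : ContDiffAt ℂ 1 φ (0, 0))
    (hD : HasDerivAt (fun u => φ (0, u)) D 0) (hD0 : D ≠ 0) (h0 : φ (0, 0) = 0) :
    ∃ ψ : E → ℂ, ψ 0 = 0 ∧ ContDiffAt ℂ 1 ψ 0 ∧ ∀ᶠ e in 𝓝 0, φ (e, ψ e) = 0 := by
  have hinv : (fderiv ℂ φ (0, 0) ∘L .inr ℂ E ℂ).IsInvertible := by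
    refine ⟨ContinuousLinearEquiv.unitsEquivAut ℂ (Units.mk0 D hD0), ?_⟩
    ext
    have h1 : HasFDerivAt (fun u : ℂ => φ (0, u)) (fderiv ℂ φ (0, 0) ∘L .inr ℂ E ℂ) 0 :=
      HasFDerivAt.comp (0 : ℂ) (hφ.differentiableAt one_ne_zero).hasFDerivAt
        (hasFDerivAt_prodMk_right (0 : E) (0 : ℂ))
    rw [← hD.unique h1.hasDerivAt]
    simp
  refine ⟨hφ.implicitFunction one_ne_zero hinv, hφ.implicitFunction_apply_self one_ne_zero hinv,
    hφ.contDiffAt_implicitFunction one_ne_zero hinv, ?_⟩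
  simpa only [h0] using hφ.eventually_apply_implicitFunction one_ne_zero hinv

end Calculus

section Bigraded

/-- The derivative of `F` at `(x, y)` in the direction `(v, 0)`. -/
def gradX (F : MvPolynomial (Fin 3 ⊕ Fin 3) ℂ) (x y v : Fin 3 → ℂ) : ℂ :=
  ∑ i, eval (Sum.elim x y) (pderiv (Sum.inl i) F) * v i

/-- The derivative of `F` at `(x, y)` in the direction `(0, v)`. -/
def gradY (F : MvPolynomial (Fin 3 ⊕ Fin 3) ℂ) (x y v : Fin 3 → ℂ) : ℂ :=
  ∑ i, eval (Sum.elim x y) (pderiv (Sum.inr i) F) * v i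

variable {F : MvPolynomial (Fin 3 ⊕ Fin 3) ℂ} {a b : ℕ}

lemma gradX_zero (x y : Fin 3 → ℂ) : gradX F x y 0 = 0 := by simp [gradX]

lemma gradX_add (x y u v : Fin 3 → ℂ) :
    gradX F x y (u + v) = gradX F x y u + gradX F x y v := by
  simp [gradX, mul_add, Finset.sum_add_distrib]

lemma gradX_smul (x y v : Fin 3 → ℂ) (t : ℂ) : gradX F x y (t • v) = t * gradX F x y v := by
  simp only [gradX, Finset.mul_sum, Pi.smul_apply, smul_eq_mul, mul_left_comm]

lemma gradY_add (x y u v : Fin 3 → ℂ) :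
    gradY F x y (u + v) = gradY F x y u + gradY F x y v := by
  simp [gradY, mul_add, Finset.sum_add_distrib]

lemma gradY_smul (x y v : Fin 3 → ℂ) (t : ℂ) : gradY F x y (t • v) = t * gradY F x y v := by
  simp only [gradY, Finset.mul_sum, Pi.smul_apply, smul_eq_mul, mul_left_comm]

lemma gradX_single (x y : Fin 3 → ℂ) (i : Fin 3) :
    gradX F x y (Pi.single i 1) = eval (Sum.elim x y) (pderiv (Sum.inl i) F) := by
  simp [gradX, Pi.single_apply]

lemma gradY_single (x y : Fin 3 → ℂ) (i : Fin 3) :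
    gradY F x y (Pi.single i 1) = eval (Sum.elim x y) (pderiv (Sum.inr i) F) := by
  simp [gradY, Pi.single_apply]

lemma gradX_self (hF : F.IsWeightedHomogeneous (wx 3) a) (x y : Fin 3 → ℂ) :
    gradX F x y x = a * eval (Sum.elim x y) F := by
  have h := congrArg (eval (Sum.elim x y)) hF.sum_weight_X_mul_pderiv
  simpa [wx, gradX, mul_comm] using h

lemma gradY_self (hF : F.IsWeightedHomogeneous (wy 3) b) (x y : Fin 3 → ℂ) :
    gradY F x y y = b * eval (Sum.elim x y) F := by
  have h := congrArg (eval (Sum.elim x y)) hF.sum_weight_X_mul_pderiv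
  simpa [wy, gradY, mul_comm] using h

lemma hasDerivAt_eval_sumElim {cx cy : ℂ → Fin 3 → ℂ} {cx' cy' : Fin 3 → ℂ} {t : ℂ}
    (hx : HasDerivAt cx cx' t) (hy : HasDerivAt cy cy' t) :
    HasDerivAt (fun s => eval (Sum.elim (cx s) (cy s)) F)
      (gradX F (cx t) (cy t) cx' + gradY F (cx t) (cy t) cy') t := by
  have h := hasDerivAt_eval F (c := fun s => Sum.elim (cx s) (cy s)) (c' := Sum.elim cx' cy')
    (t := t) (by
      rintro (i | i)
      exacts [hasDerivAt_pi.1 hx i, hasDerivAt_pi.1 hy i])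
  simpa [gradX, gradY] using h

lemma eval_smul_left (hF : F.IsWeightedHomogeneous (wx 3) a) (t : ℂ) (x y : Fin 3 → ℂ) :
    eval (Sum.elim (t • x) y) F = t ^ a * eval (Sum.elim x y) F := by
  rw [← IsWeightedHomogeneous.eval_pow_mul hF]
  congr 2
  ext (i | i) <;> simp [wx]

lemma eval_smul_right (hF : F.IsWeightedHomogeneous (wy 3) b) (t : ℂ) (x y : Fin 3 → ℂ) :
    eval (Sum.elim x (t • y)) F = t ^ b * eval (Sum.elim x y) F := by
  rw [← IsWeightedHomogeneous.eval_pow_mul hF]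
  congr 2
  ext (i | i) <;> simp [wy]

lemma eval_eq_of_left_degree_zero (hF : F.IsWeightedHomogeneous (wx 3) 0) (x x' y : Fin 3 → ℂ) :
    eval (Sum.elim x y) F = eval (Sum.elim x' y) F := by
  have h := eval_smul_left hF 0 x y
  have h' := eval_smul_left hF 0 x' y
  simp only [zero_smul, pow_zero, one_mul] at h h'
  rw [← h, h']

lemma eval_eq_of_right_degree_zero (hF : F.IsWeightedHomogeneous (wy 3) 0) (x y y' : Fin 3 → ℂ) :
    eval (Sum.elim x y) F = eval (Sum.elim x y') F := by
  have h := eval_smul_right hF 0 x y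
  have h' := eval_smul_right hF 0 x y'
  simp only [zero_smul, pow_zero, one_mul] at h h'
  rw [← h, h']

lemma eval_zero_left (hF : F.IsWeightedHomogeneous (wx 3) a) (ha : a ≠ 0) (y : Fin 3 → ℂ) :
    eval (Sum.elim 0 y) F = 0 := by
  simpa [ha] using eval_smul_left hF 0 0 y

lemma eval_zero_right (hF : F.IsWeightedHomogeneous (wy 3) b) (hb : b ≠ 0) (x : Fin 3 → ℂ) :
    eval (Sum.elim x 0) F = 0 := by
  simpa [hb] using eval_smul_right hF 0 x 0

/-- A form of positive degree in `y` has two distinct zeros in the projective plane. -/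
lemma exists_two_zeros (hF : F.IsWeightedHomogeneous (wy 3) b) (hb : b ≠ 0) (x : Fin 3 → ℂ) :
    ∃ y y' : Fin 3 → ℂ, LinearIndependent ℂ ![y, y'] ∧ eval (Sum.elim x y) F = 0 ∧
      eval (Sum.elim x y') F = 0 := by
  have key : ∀ u v : Fin 3 → ℂ, ∃ s t : ℂ, (s ≠ 0 ∨ t ≠ 0) ∧
      eval (Sum.elim x (s • u + t • v)) F = 0 := by
    intro u v
    obtain ⟨s, t, hst, h⟩ := exists_eval_add_smul_eq_zero F (Sum.elim x 0) (Sum.elim 0 u)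
      (Sum.elim 0 v) (eval_zero_right hF hb x)
    refine ⟨s, t, hst, ?_⟩
    rw [← h]
    congr 2
    ext (i | i) <;> simp
  obtain ⟨s, t, hst, h1⟩ := key (Pi.single 0 1) (Pi.single 1 1)
  by_cases ht : t = 0
  · obtain ⟨s', t', hst', h2⟩ := key (Pi.single 1 1) (Pi.single 2 1)
    refine ⟨_, _, LinearIndependent.pair_iff.2 fun c d hcd => ?_, h1, h2⟩
    have e0 := congrFun hcd 0
    have e1 := congrFun hcd 1
    have e2 := congrFun hcd 2
    simp at e0 e1 e2
    grind
  · obtain ⟨s', t', hst', h2⟩ := key (Pi.single 0 1) (Pi.single 2 1)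
    refine ⟨_, _, LinearIndependent.pair_iff.2 fun c d hcd => ?_, h1, h2⟩
    have e0 := congrFun hcd 0
    have e1 := congrFun hcd 1
    have e2 := congrFun hcd 2
    simp at e0 e1 e2
    grind

/-- The curve cut out by `F` in `{x} × ℙ²`. -/
def fiberPoly (F : MvPolynomial (Fin 3 ⊕ Fin 3) ℂ) (x : Fin 3 → ℂ) : MvPolynomial (Fin 3) ℂ :=
  aeval (Sum.elim (fun i => C (x i)) X) F

lemma eval_fiberPoly (x y : Fin 3 → ℂ) : eval y (fiberPoly F x) = eval (Sum.elim x y) F := by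
  rw [fiberPoly, ← aeval_eq_eval, algHom_aeval_eq_eval]
  congr 2
  ext (i | i) <;> simp

lemma isHomogeneous_fiberPoly (hF : F.IsWeightedHomogeneous (wy 3) b) (x : Fin 3 → ℂ) :
    (fiberPoly F x).IsHomogeneous b := by
  rw [fiberPoly, aeval_def, eval₂_eq]
  refine IsHomogeneous.sum _ _ _ fun d hd => ?_
  have hw : ∑ i ∈ d.support, wy 3 i * d i = b := by
    have := hF (mem_support_iff.1 hd)
    simpa [Finsupp.weight_apply, Finsupp.sum, mul_comm] using this
  rw [← zero_add b, ← hw]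
  refine (isHomogeneous_C _ _).mul (IsHomogeneous.prod _ _ _ fun i _ => ?_)
  rcases i with i | i
  · simpa [wy] using (isHomogeneous_C (Fin 3) (x i)).pow (d (Sum.inl i))
  · simpa [wy] using (isHomogeneous_X ℂ i).pow (d (Sum.inr i))

/-- Over `U`, the zero set of `F` contains no `(2,2)`-grid of pairs of distinct projective
points. -/
def NoGridOver (F : MvPolynomial (Fin 3 ⊕ Fin 3) ℂ) (U : Set (Fin 3 → ℂ)) : Prop :=
  ∀ x ∈ U, ∀ x' ∈ U, ∀ y y', LinearIndependent ℂ ![x, x'] → LinearIndependent ℂ ![y, y'] →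
    eval (Sum.elim x y) F = 0 → eval (Sum.elim x y') F = 0 →
    eval (Sum.elim x' y) F = 0 → eval (Sum.elim x' y') F = 0 → False

lemma hasDerivAt_add_smul (y v : Fin 3 → ℂ) (t : ℂ) :
    HasDerivAt (fun s : ℂ => y + s • v) v t := by
  simpa using ((hasDerivAt_id t).smul_const v).const_add y

lemma deriv_eval_fiberPoly (x y v : Fin 3 → ℂ) :
    deriv (fun t : ℂ => eval (y + t • v) (fiberPoly F x)) 0 = gradY F x y v := by
  have h := hasDerivAt_eval_sumElim (F := F) (hasDerivAt_const (0 : ℂ) x)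
    (hasDerivAt_add_smul y v 0)
  simp only [eval_fiberPoly]
  rw [h.deriv, gradX_zero]
  simp

/-- If two fibres over `U` meet at a smooth point, they are tangent there. -/
lemma gradY_eq_zero_of_gradY_eq_zero {U : Set (Fin 3 → ℂ)} (hF : F.IsWeightedHomogeneous (wy 3) b)
    (hb : 2 ≤ b) (hU : NoGridOver F U) {x x' y n τ : Fin 3 → ℂ} (hx : x ∈ U) (hx' : x' ∈ U)
    (hxx' : LinearIndependent ℂ ![x, x']) (hy : y ≠ 0) (h : eval (Sum.elim x y) F = 0)
    (h' : eval (Sum.elim x' y) F = 0) (hn : gradY F x y n ≠ 0) (hτ : gradY F x y τ = 0) :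
    gradY F x' y τ = 0 := by
  by_contra hne
  have hsy : gradY F x y y = 0 := by rw [gradY_self hF, h, mul_zero]
  have hsy' : gradY F x' y y = 0 := by rw [gradY_self hF, h', mul_zero]
  have htr : ∀ s t : ℂ, gradY F x y (s • τ + t • n) = 0 → gradY F x' y (s • τ + t • n) = 0 →
      s = 0 ∧ t = 0 := by
    intro s t h1 h2
    simp only [gradY_add, gradY_smul] at h1 h2
    have ht : t = 0 := by simpa [hτ, hn] using h1
    subst ht
    exact ⟨by simpa [hne] using h2, rfl⟩
  obtain ⟨q, hq, h1, h2⟩ := exists_second_common_zero (f := fiberPoly F x) (g := fiberPoly F x')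
    hb (isHomogeneous_fiberPoly hF x) (isHomogeneous_fiberPoly hF x') (p := y) (u := τ) (v := n)
    (by
      intro c s t hc
      have e1 := congrArg (gradY F x y) hc
      have e2 := congrArg (gradY F x' y) hc
      rw [gradY_add, gradY_smul, hsy, mul_zero, zero_add] at e1
      rw [gradY_add, gradY_smul, hsy', mul_zero, zero_add] at e2
      obtain ⟨rfl, rfl⟩ := htr s t (by simpa [gradY] using e1) (by simpa [gradY] using e2)
      exact ⟨by simpa [hy] using hc, rfl, rfl⟩)
    (by rwa [eval_fiberPoly]) (by rwa [eval_fiberPoly])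
    (fun s t e1 e2 => htr s t (by rwa [deriv_eval_fiberPoly] at e1)
      (by rwa [deriv_eval_fiberPoly] at e2))
  rw [eval_fiberPoly] at h1 h2
  exact hU x hx x' hx' y q hxx' hq h h1 h' h2

lemma exists_linearIndependent_triple {u v : Fin 3 → ℂ} (h : LinearIndependent ℂ ![u, v]) :
    ∃ w : Fin 3 → ℂ, ∀ c s t : ℂ, c • u + (s • v + t • w) = 0 → c = 0 ∧ s = 0 ∧ t = 0 := by
  obtain ⟨w, hw⟩ := exists_linearIndependent_snoc_of_lt_finrank h (by simp)
  refine ⟨w, fun c s t hc => ?_⟩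
  have h1 := Fintype.linearIndependent_iff.1 hw ![c, s, t] (by
    rw [← hc]
    simp [Fin.sum_univ_three, Fin.snoc, add_assoc])
  exact ⟨h1 0, h1 1, h1 2⟩

lemma linearIndependent_pair_of_triple {u v w : Fin 3 → ℂ}
    (h : ∀ c s t : ℂ, c • u + (s • v + t • w) = 0 → c = 0 ∧ s = 0 ∧ t = 0) {s t : ℂ}
    (ht : t ≠ 0) : LinearIndependent ℂ ![u, u + (s • v + t • w)] := by
  refine LinearIndependent.pair_iff.2 fun c d hcd => ?_
  obtain ⟨h1, -, h3⟩ := h (c + d) (d * s) (d * t) (by rw [← hcd]; module)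
  have hd : d = 0 := by simpa [ht] using h3
  exact ⟨by simpa [hd] using h1, hd⟩

lemma contDiffAt_eval_sumElim {E : Type*} [NormedAddCommGroup E] [NormedSpace ℂ E]
    (p : MvPolynomial (Fin 3 ⊕ Fin 3) ℂ) {cx cy : E → Fin 3 → ℂ} {e : E}
    (hx : ContDiffAt ℂ 1 cx e) (hy : ContDiffAt ℂ 1 cy e) :
    ContDiffAt ℂ 1 (fun z => eval (Sum.elim (cx z) (cy z)) p) e := by
  refine contDiffAt_eval p (c := fun z => Sum.elim (cx z) (cy z)) ?_
  rintro (i | i)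
  exacts [contDiffAt_pi.1 hx i, contDiffAt_pi.1 hy i]

lemma linearIndependent_pair_of_map_ne_zero {y n : Fin 3 → ℂ} (hy : y ≠ 0) (L : (Fin 3 → ℂ) → ℂ)
    (hadd : ∀ u v, L (u + v) = L u + L v) (hsmul : ∀ (t : ℂ) v, L (t • v) = t * L v)
    (h0 : L y = 0) (hn : L n ≠ 0) : LinearIndependent ℂ ![y, n] := by
  refine LinearIndependent.pair_iff.2 fun c d hcd => ?_
  have h1 := congrArg L hcd
  have hz : L 0 = 0 := by simpa using hsmul 0 0
  rw [hadd, hsmul, hsmul, h0, hz, mul_zero, zero_add] at h1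
  have hd : d = 0 := by simpa [hn] using h1
  exact ⟨by simpa [hd, hy] using hcd, hd⟩

open Topology in
/-- A grid-free family of curves of degree at least two has no point at which both partial
gradients are nonzero. -/
lemma NoGridOver.false_of_grad_ne_zero {U : Set (Fin 3 → ℂ)} (hU : NoGridOver F U)
    (hUo : IsOpen U) (hFx : F.IsWeightedHomogeneous (wx 3) a)
    (hF : F.IsWeightedHomogeneous (wy 3) b) (hb : 2 ≤ b) {x y n e : Fin 3 → ℂ} (hxU : x ∈ U)
    (hx : x ≠ 0) (hy : y ≠ 0) (h : eval (Sum.elim x y) F = 0) (he : gradX F x y e ≠ 0)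
    (hn : gradY F x y n ≠ 0) : False := by
  obtain ⟨τ, hτ⟩ := exists_linearIndependent_triple (linearIndependent_pair_of_map_ne_zero hy
    (gradY F x y) (gradY_add x y) (fun t v => gradY_smul x y v t)
    (by rw [gradY_self hF, h, mul_zero]) hn)
  obtain ⟨f, hf⟩ := exists_linearIndependent_triple (linearIndependent_pair_of_map_ne_zero hx
    (gradX F x y) (gradX_add x y) (fun t v => gradX_smul x y v t)
    (by rw [gradX_self hFx, h, mul_zero]) he)
  obtain ⟨w, hw0, hw, hwF⟩ := exists_implicit (E := ℂ) (D := gradY F x y n)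
    (φ := fun p => eval (Sum.elim x (y + (p.2 • n + p.1 • τ))) F)
    (contDiffAt_eval_sumElim F contDiffAt_const (by fun_prop))
    (by
      have h1 := hasDerivAt_eval_sumElim (F := F) (hasDerivAt_const (0 : ℂ) x)
        (hasDerivAt_add_smul y n 0)
      simpa [gradX_zero] using h1)
    hn (by simpa using h)
  let γ : ℂ → Fin 3 → ℂ := fun s => y + (w s • n + s • τ)
  have hγ0 : γ 0 = y := by simp [γ, hw0]
  have hγ : ContDiffAt ℂ 1 γ 0 := by fun_prop
  obtain ⟨ψ, hψ0, hψ, hψF⟩ := exists_implicit (E := ℂ × ℂ) (D := gradX F x y e)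
    (φ := fun p => eval (Sum.elim (x + (p.2 • e + p.1.1 • f)) (γ p.1.2)) F)
    (contDiffAt_eval_sumElim F (by fun_prop)
      (ContDiffAt.comp (g := γ) (f := fun p : (ℂ × ℂ) × ℂ => p.1.2) _ hγ (by fun_prop)))
    (by
      have h1 := hasDerivAt_eval_sumElim (F := F) (hasDerivAt_add_smul x e 0)
        (hasDerivAt_const (0 : ℂ) y)
      simpa [gradY, hγ0] using h1)
    he (by simpa [hγ0] using h)
  let ξ : ℂ × ℂ → Fin 3 → ℂ := fun p => x + (ψ p • e + p.1 • f)
  have hξ0 : ξ 0 = x := by simp [ξ, hψ0]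
  have hξ : ContDiffAt ℂ 1 ξ 0 := by fun_prop
  have hγ2 : ContDiffAt ℂ 1 (fun p : ℂ × ℂ => γ p.2) 0 :=
    ContDiffAt.comp (g := γ) (f := fun p : ℂ × ℂ => p.2) _ hγ (by fun_prop)
  have hsnd : Filter.Tendsto (fun p : ℂ × ℂ => p.2) (𝓝 0) (𝓝 0) := continuous_snd.tendsto 0
  have hcont : ∀ (G : MvPolynomial (Fin 3 ⊕ Fin 3) ℂ),
      ContinuousAt (fun p : ℂ × ℂ => eval (Sum.elim (ξ p) (γ p.2)) G) 0 ∧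
      ContinuousAt (fun p : ℂ × ℂ => eval (Sum.elim x (γ p.2)) G) 0 := fun G =>
    ⟨(contDiffAt_eval_sumElim G hξ hγ2).continuousAt,
      (contDiffAt_eval_sumElim G contDiffAt_const hγ2).continuousAt⟩
  have hgX : ContinuousAt (fun p : ℂ × ℂ => gradX F (ξ p) (γ p.2) e) 0 := by
    unfold gradX
    exact tendsto_finsetSum _ fun i _ => (hcont _).1.mul continuousAt_const
  have hgY : ContinuousAt (fun p : ℂ × ℂ => gradY F x (γ p.2) n) 0 := by
    unfold gradY
    exact tendsto_finsetSum _ fun i _ => (hcont _).2.mul continuousAt_const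
  have hev : ∀ᶠ p : ℂ × ℂ in 𝓝 0, eval (Sum.elim x (γ p.2)) F = 0 ∧
      eval (Sum.elim (ξ p) (γ p.2)) F = 0 ∧ DifferentiableAt ℂ w p.2 ∧ DifferentiableAt ℂ ψ p ∧
      gradX F (ξ p) (γ p.2) e ≠ 0 ∧ gradY F x (γ p.2) n ≠ 0 ∧ ξ p ∈ U := by
    have hgX0 : gradX F (ξ 0) (γ (0 : ℂ × ℂ).2) e ≠ 0 := by simpa [hξ0, hγ0] using he
    have hgY0 : gradY F x (γ (0 : ℂ × ℂ).2) n ≠ 0 := by simpa [hγ0] using hn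
    filter_upwards [hsnd.eventually hwF, hψF, hsnd.eventually (hw.eventually (by simp)),
      hψ.eventually (by simp), hgX.eventually_ne hgX0, hgY.eventually_ne hgY0,
      hξ.continuousAt.eventually_mem (hUo.mem_nhds (by rwa [hξ0]))] with p h1 h2 h3 h4 h5 h6 h7
    exact ⟨h1, h2, h3.differentiableAt one_ne_zero, h4.differentiableAt one_ne_zero, h5, h6, h7⟩
  obtain ⟨ε, hε, hball⟩ := Metric.eventually_nhds_iff_ball.1 hev
  have hball' : ∀ v ∈ Metric.ball (0 : ℂ) ε, ∀ s ∈ Metric.ball (0 : ℂ) ε,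
      (v, s) ∈ Metric.ball (0 : ℂ × ℂ) ε := fun v hv s hs => by
    rw [mem_ball_zero_iff] at hv hs ⊢
    exact max_lt hv hs
  obtain ⟨v, hv0, hv⟩ : ∃ v : ℂ, v ≠ 0 ∧ v ∈ Metric.ball (0 : ℂ) ε := by
    refine ⟨(ε / 2 : ℝ), by exact_mod_cast (half_pos hε).ne', ?_⟩
    rw [mem_ball_zero_iff, Complex.norm_real, Real.norm_of_nonneg (half_pos hε).le]
    exact half_lt_self hε
  have h0ball : (0 : ℂ) ∈ Metric.ball (0 : ℂ) ε := Metric.mem_ball_self hε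
  have hli : ∀ s, LinearIndependent ℂ ![x, ξ (v, s)] := fun s =>
    linearIndependent_pair_of_triple hf hv0
  have hderiv : ∀ s ∈ Metric.ball (0 : ℂ) ε, HasDerivAt (fun s => ψ (v, s)) 0 s := by
    intro s hs
    obtain ⟨h1, h2, h3, h4, h5, h6, h7⟩ := hball _ (hball' v hv s hs)
    have hγs : γ s ≠ 0 := fun hc => one_ne_zero (hτ 1 (w s) s (by rw [one_smul]; exact hc)).1
    have hγd : HasDerivAt γ (deriv w s • n + τ) s :=
      (((h3.hasDerivAt.smul_const n).add ((hasDerivAt_id s).smul_const τ)).const_add y).congr_deriv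
        (by simp)
    have hψd : DifferentiableAt ℂ (fun s => ψ (v, s)) s :=
      DifferentiableAt.comp (g := ψ) (f := fun s : ℂ => (v, s)) s h4 (by fun_prop)
    have hξd : HasDerivAt (fun s => ξ (v, s)) (deriv (fun s => ψ (v, s)) s • e) s :=
      ((hψd.hasDerivAt.smul_const e).add_const (v • f)).const_add x
    have hnhds : Metric.ball (0 : ℂ) ε ∈ 𝓝 s := Metric.isOpen_ball.mem_nhds hs
    have d1 := (hasDerivAt_eval_sumElim (F := F) (hasDerivAt_const s x) hγd).unique
      ((hasDerivAt_const s (0 : ℂ)).congr_of_eventuallyEq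
        (Filter.mem_of_superset hnhds fun s' hs' => (hball _ (hball' v hv s' hs')).1))
    have d2 := (hasDerivAt_eval_sumElim (F := F) hξd hγd).unique
      ((hasDerivAt_const s (0 : ℂ)).congr_of_eventuallyEq
        (Filter.mem_of_superset hnhds fun s' hs' => (hball _ (hball' v hv s' hs')).2.1))
    rw [gradX_zero, zero_add] at d1
    rw [gradY_eq_zero_of_gradY_eq_zero hF hb hU hxU h7 (hli s) hγs h1 h2 h6 d1, add_zero,
      gradX_smul] at d2
    have hz := (mul_eq_zero.1 d2).resolve_right h5
    rw [← hz]
    exact hψd.hasDerivAt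
  have hconst : ψ (v, v) = ψ (v, 0) :=
    Metric.isOpen_ball.is_const_of_deriv_eq_zero (convex_ball (0 : ℂ) ε).isPreconnected
      (f := fun s => ψ (v, s)) (fun s hs => (hderiv s hs).differentiableAt.differentiableWithinAt)
      (fun s hs => (hderiv s hs).deriv) hv h0ball
  obtain ⟨-, k2, -, -, -, -, k7⟩ := hball _ (hball' v hv 0 h0ball)
  obtain ⟨l1, l2, -⟩ := hball _ (hball' v hv v hv)
  have hξv : ξ (v, v) = ξ (v, 0) := by simp only [ξ, hconst]
  rw [hξv] at l2
  refine hU x hxU _ k7 y (γ v) (hli 0) (linearIndependent_pair_of_triple hτ hv0) h l1 ?_ l2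
  simpa only [hγ0] using k2

lemma exists_mem_linearIndependent_pair {U : Set (Fin 3 → ℂ)} (hUo : IsOpen U)
    {x : Fin 3 → ℂ} (hxU : x ∈ U) (hx : x ≠ 0) :
    ∃ x' ∈ U, LinearIndependent ℂ ![x, x'] := by
  obtain ⟨e, he⟩ := exists_linearIndependent_pair_of_one_lt_finrank (R := ℂ)
    (M := Fin 3 → ℂ) (by simp) hx
  obtain ⟨f, hf⟩ := exists_linearIndependent_triple he
  have hc : ContinuousAt (fun t : ℂ => x + ((0 : ℂ) • e + t • f)) 0 := by fun_prop
  have hev := hc.eventually_mem (hUo.mem_nhds (by simpa using hxU))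
  obtain ⟨t, ht, ht0⟩ := ((hev.filter_mono nhdsWithin_le_nhds).and
    (self_mem_nhdsWithin (s := {0}ᶜ))).exists
  exact ⟨_, ht, linearIndependent_pair_of_triple hf ht0⟩

lemma totalDegree_pos_of_irreducible {σ : Type*} {p : MvPolynomial σ ℂ} (hp : Irreducible p) :
    0 < p.totalDegree := by
  refine Nat.pos_of_ne_zero fun h => hp.not_isUnit ?_
  have h1 := totalDegree_eq_zero_iff_eq_C.1 h
  rw [h1]
  refine IsUnit.map C (isUnit_iff_ne_zero.2 fun hc => hp.ne_zero ?_)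
  rw [h1, hc, C_0]

/-- A bihomogeneous polynomial of minimal degree with a given grid-free zero set over a Zariski
open set has degree at most one in `y`. -/
lemma NoGridOver.false_of_minimal {S : Set (MvPolynomial (Fin 3) ℂ)} {U : Set (Fin 3 → ℂ)}
    (hUS : U = {x | ∃ g ∈ S, eval x g ≠ 0}) (hU : NoGridOver F U) (hF0 : F ≠ 0)
    (hFx : F.IsWeightedHomogeneous (wx 3) a) (hFy : F.IsWeightedHomogeneous (wy 3) b) (hb : 2 ≤ b)
    (hmin : ∀ G, G ≠ 0 → Bihom G → (∀ x ∈ U, x ≠ 0 → ∀ y, y ≠ 0 →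
      (eval (Sum.elim x y) F = 0 ↔ eval (Sum.elim x y) G = 0)) →
      F.totalDegree ≤ G.totalDegree) : False := by
  have hUo : IsOpen U := by
    have : U = ⋃ g ∈ S, {x | eval x g ≠ 0} := by
      ext x
      simp [hUS]
    rw [this]
    exact isOpen_biUnion fun g _ => isOpen_ne_fun (continuous_eval g) continuous_const
  have hFu : ¬ IsUnit F := by
    intro hu
    obtain ⟨y, -, -, hy, -⟩ := exists_two_zeros hFy (by omega) 0
    exact (hu.map (eval (Sum.elim 0 y))).ne_zero hy
  obtain ⟨P, hP, R, hPR⟩ := WfDvdMonoid.exists_irreducible_factor hFu hF0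
  have hR0 : R ≠ 0 := right_ne_zero_of_mul (hPR ▸ hF0)
  have hFPR : ∀ x y, eval (Sum.elim x y) F = eval (Sum.elim x y) P * eval (Sum.elim x y) R := by
    intro x y
    rw [hPR, map_mul]
  have hRP : F = R * P := by rw [hPR, mul_comm]
  obtain ⟨aP, hPx⟩ := exists_isWeightedHomogeneous_left_of_mul (hPR ▸ hFx) (hPR ▸ hF0)
  obtain ⟨bP, hPy⟩ := exists_isWeightedHomogeneous_left_of_mul (hPR ▸ hFy) (hPR ▸ hF0)
  obtain ⟨aR, hRx⟩ := exists_isWeightedHomogeneous_left_of_mul (hRP ▸ hFx) (hRP ▸ hF0)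
  obtain ⟨bR, hRy⟩ := exists_isWeightedHomogeneous_left_of_mul (hRP ▸ hFy) (hRP ▸ hF0)
  obtain ⟨x, hxU, hx, y, hy, hPxy, hRxy⟩ : ∃ x ∈ U, x ≠ 0 ∧ ∃ y, y ≠ 0 ∧
      eval (Sum.elim x y) P = 0 ∧ eval (Sum.elim x y) R ≠ 0 := by
    by_contra! hc
    have h1 := hmin R hR0 ⟨aR, bR, hRx, hRy⟩ fun x hxU hx y hy => by
      rw [hFPR, mul_eq_zero]
      exact ⟨fun h => h.elim (hc x hxU hx y hy) id, Or.inr⟩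
    rw [hPR, totalDegree_mul_of_isDomain hP.ne_zero hR0] at h1
    have := totalDegree_pos_of_irreducible hP
    omega
  obtain ⟨x', hxU', hxx'⟩ := exists_mem_linearIndependent_pair hUo hxU hx
  have hbP : bP ≠ 0 := by
    rintro rfl
    have h0 : ∀ z, eval (Sum.elim x z) F = 0 := fun z => by
      rw [hFPR, eval_eq_of_right_degree_zero hPy x z y, hPxy, zero_mul]
    obtain ⟨z, z', hz, h1, h2⟩ := exists_two_zeros hFy (by omega) x'
    exact hU x hxU x' hxU' z z' hxx' hz (h0 z) (h0 z') h1 h2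
  have haP : aP ≠ 0 := by
    rintro rfl
    obtain ⟨z, z', hz, h1, h2⟩ := exists_two_zeros hPy hbP x
    refine hU x hxU x' hxU' z z' hxx' hz ?_ ?_ ?_ ?_
    · rw [hFPR, h1, zero_mul]
    · rw [hFPR, h2, zero_mul]
    · rw [hFPR, eval_eq_of_left_degree_zero hPx x' x, h1, zero_mul]
    · rw [hFPR, eval_eq_of_left_degree_zero hPx x' x, h2, zero_mul]
  have haF : a = aP + aR := hFx.inj_right hF0 (hPR ▸ hPx.mul hRx)
  have hPp : Prime P := hP.prime
  have hPR' : ¬ P ∣ R := by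
    rintro ⟨Q, rfl⟩
    exact hRxy (by rw [map_mul, hPxy, zero_mul])
  obtain ⟨j, hj, hPj⟩ : ∃ j, wx 3 (Sum.inl j) = 1 ∧ pderiv (Sum.inl j) P ≠ 0 := by
    obtain ⟨j | j, h1, h2⟩ := exists_pderiv_ne_zero hPx haP hP.ne_zero
    exacts [⟨j, rfl, h2⟩, absurd rfl h1]
  obtain ⟨i, hi, hPi⟩ : ∃ i, wy 3 (Sum.inr i) = 1 ∧ pderiv (Sum.inr i) P ≠ 0 := by
    obtain ⟨i | i, h1, h2⟩ := exists_pderiv_ne_zero hPy hbP hP.ne_zero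
    exacts [absurd rfl h1, ⟨i, rfl, h2⟩]
  have hFj : ¬ P ∣ pderiv (Sum.inl j) F := hPR ▸ not_dvd_pderiv_mul hPp hPR'
    fun h => hPj (pderiv_eq_zero_of_dvd hPx haP hj h)
  have hFi : ¬ P ∣ pderiv (Sum.inr i) F := hPR ▸ not_dvd_pderiv_mul hPp hPR'
    fun h => hPi (pderiv_eq_zero_of_dvd hPy hbP hi h)
  obtain ⟨g, hgS, hgx⟩ : ∃ g ∈ S, eval x g ≠ 0 := by simpa [hUS] using hxU
  have hg : ¬ P ∣ rename Sum.inl g := by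
    rintro ⟨Q, hQ⟩
    have h1 := congrArg (eval (Sum.elim x (0 : Fin 3 → ℂ))) hQ
    rw [map_mul, eval_zero_right hPy hbP, zero_mul, eval_rename, Sum.elim_comp_inl] at h1
    exact hgx h1
  obtain ⟨z, hzP, hz⟩ := exists_eval_eq_zero_of_not_dvd hPp
    (hPp.not_dvd_mul (hPp.not_dvd_mul hFj hFi) hg)
  obtain ⟨u, v, rfl⟩ : ∃ u v, z = Sum.elim u v :=
    ⟨_, _, (Sum.elim_comp_inl_inr z).symm⟩
  simp only [map_mul, eval_rename, Sum.elim_comp_inl, mul_ne_zero_iff] at hz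
  obtain ⟨⟨hzj, hzi⟩, hzg⟩ := hz
  refine hU.false_of_grad_ne_zero hUo hFx hFy hb (x := u) (y := v) (n := Pi.single i 1)
    (e := Pi.single j 1) (by rw [hUS]; exact ⟨g, hgS, hzg⟩) ?_ ?_ (by rw [hFPR, hzP, zero_mul])
    ((gradX_single u v j).trans_ne hzj) ((gradY_single u v i).trans_ne hzi)
  · rintro rfl
    exact hzi (eval_zero_left (hFx.pderiv (n' := a) rfl) (by omega) v)
  · rintro rfl
    exact hzj (eval_zero_right (hFy.pderiv (n' := b) rfl) (by omega) u)

end Bigraded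

lemma GridFree.noGridOver {F : MvPolynomial (Fin 3 ⊕ Fin 3) ℂ} (hF : Bihom F)
    {S : Finset (MvPolynomial (Fin 3) ℂ)} (hS : ∀ g ∈ S, ∃ d, g.IsHomogeneous d)
    (h : GridFree 2 2 (zeroSet F ∩
      {p : Pt 3 | ¬ ∀ g ∈ S, eval p.rep g = 0} ×ˢ (Set.univ : Set (Pt 3)))) :
    NoGridOver F {x | ∃ g ∈ (S : Set (MvPolynomial (Fin 3) ℂ)), eval x g ≠ 0} := by
  classical
  obtain ⟨a, b, hFx, hFy⟩ := hF
  rintro x ⟨g, hg, hgx⟩ x' ⟨g', hg', hgx'⟩ y y' hx hy h1 h2 h3 h4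
  have hne : ∀ {u v : Fin 3 → ℂ}, LinearIndependent ℂ ![u, v] → ∃ (hu : u ≠ 0) (hv : v ≠ 0),
      Projectivization.mk ℂ u hu ≠ Projectivization.mk ℂ v hv := by
    intro u v huv
    have hu : u ≠ 0 := huv.ne_zero 0
    have hv : v ≠ 0 := huv.ne_zero 1
    refine ⟨hu, hv, fun he => ?_⟩
    obtain ⟨c, hc⟩ := (Projectivization.mk_eq_mk_iff' ℂ u v hu hv).1 he
    have := (LinearIndependent.pair_iff.1 huv) 1 (-c) (by rw [← hc]; module)
    exact one_ne_zero this.1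
  obtain ⟨hx0, hx0', hxne⟩ := hne hx
  obtain ⟨hy0, hy0', hyne⟩ := hne hy
  have hmem : ∀ {u v : Fin 3 → ℂ} (hu : u ≠ 0) (hv : v ≠ 0) {g}, g ∈ S → eval u g ≠ 0 →
      eval (Sum.elim u v) F = 0 → (Projectivization.mk ℂ u hu, Projectivization.mk ℂ v hv) ∈
        zeroSet F ∩ {p : Pt 3 | ¬ ∀ g ∈ S, eval p.rep g = 0} ×ˢ (Set.univ : Set (Pt 3)) := by
    intro u v hu hv g hg hgu huv
    obtain ⟨c, hc⟩ := Projectivization.exists_smul_eq_mk_rep ℂ u hu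
    obtain ⟨d, hd⟩ := Projectivization.exists_smul_eq_mk_rep ℂ v hv
    rw [Units.smul_def] at hc hd
    refine ⟨?_, fun hall => ?_, Set.mem_univ _⟩
    · change eval (Sum.elim (Projectivization.mk ℂ u hu).rep
        (Projectivization.mk ℂ v hv).rep) F = 0
      rw [← hc, ← hd, eval_smul_left hFx, eval_smul_right hFy, huv, mul_zero, mul_zero]
    · obtain ⟨k, hk⟩ := hS g hg
      have h0 := hall g hg
      change eval (Projectivization.mk ℂ u hu).rep g = 0 at h0
      rw [← hc] at h0
      have h5 := IsWeightedHomogeneous.eval_pow_mul hk (c : ℂ) u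
      simp only [Pi.one_apply, pow_one] at h5
      have h6 : (c : ℂ) ^ k * eval u g = 0 := by rw [← h5, ← h0]; rfl
      exact (mul_ne_zero (pow_ne_zero k c.ne_zero) hgu) h6
  refine h ⟨{_, _}, {_, _}, Finset.card_pair hxne, Finset.card_pair hyne, ?_⟩
  intro p hp q hq
  simp only [Finset.mem_insert, Finset.mem_singleton] at hp hq
  rcases hp with rfl | rfl <;> rcases hq with rfl | rfl
  exacts [hmem _ _ hg hgx h1, hmem _ _ hg hgx h2, hmem _ _ hg' hgx' h3, hmem _ _ hg' hgx' h4]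

/-- Theorem 4.1 of the paper, the main result.  If
`H ∩ (X × ℙ²)` is `(2,2)`-grid-free, where `H = {F = 0} ⊆ ℙ² × ℙ²` for a nonzero
bihomogeneous `F` and `X ⊆ ℙ²` is nonempty Zariski-open, then there is a bihomogeneous
`F'` of degree `≤ 2` in the `y`-variables with
`H ∩ (X × ℙ²) = {F' = 0} ∩ (X × ℙ²)`. -/
theorem stmt3
    (F : MvPolynomial (Fin 3 ⊕ Fin 3) ℂ) (hF0 : F ≠ 0) (hFbh : Bihom F)
    (X : Set (Pt 3)) (hX : ZarOpen X) (hXne : X.Nonempty)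
    (hgf : GridFree 2 2 (zeroSet F ∩ X ×ˢ (Set.univ : Set (Pt 3)))) :
    ∃ F' : MvPolynomial (Fin 3 ⊕ Fin 3) ℂ, Bihom F' ∧ ydeg F' ≤ 2 ∧
      zeroSet F ∩ X ×ˢ (Set.univ : Set (Pt 3)) =
        zeroSet F' ∩ X ×ˢ (Set.univ : Set (Pt 3)) := by
  obtain ⟨S, hS, rfl⟩ := hX
  let Good : MvPolynomial (Fin 3 ⊕ Fin 3) ℂ → Prop := fun G => G ≠ 0 ∧ Bihom G ∧
    zeroSet F ∩ {p : Pt 3 | ¬ ∀ g ∈ S, eval p.rep g = 0} ×ˢ (Set.univ : Set (Pt 3)) =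
      zeroSet G ∩ {p : Pt 3 | ¬ ∀ g ∈ S, eval p.rep g = 0} ×ˢ (Set.univ : Set (Pt 3))
  obtain ⟨G, ⟨hG0, hG, hFG⟩, hmin⟩ := exists_minimalFor_of_wellFoundedLT Good
    (fun G => G.totalDegree) ⟨F, hF0, hFbh, rfl⟩
  refine ⟨G, hG, ?_, hFG⟩
  obtain ⟨a, b, hGx, hGy⟩ := id hG
  by_contra hb
  have hdeg : ydeg G = b := WithBot.coe_injective
    ((weightedTotalDegree_coe _ G hG0).symm.trans (hGy.weighted_total_degree hG0))
  rw [hdeg] at hb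
  rw [hFG] at hgf
  refine (GridFree.noGridOver hG hS hgf).false_of_minimal rfl hG0 hGx hGy (by omega)
    fun K hK0 hK hGK => ?_
  refine le_of_not_gt fun hlt => hlt.not_ge (hmin ⟨hK0, hK, ?_⟩ hlt.le)
  rw [hFG]
  ext ⟨p, q⟩
  simp only [Set.mem_inter_iff, Set.mem_prod, Set.mem_univ, and_true, and_congr_left_iff]
  intro hp
  exact hGK p.rep (by simpa using hp) p.rep_nonzero q.rep q.rep_nonzero
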